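/- Let N be a finite set of voters and let 𝒞 be an M-winning coalition set on N. Then for every profile R : N → Bool there exist C ∈ 𝒞 and x : Bool such that R i = x for all i ∈ C (i.e., at every profile some winning coalition is unanimous). -/

import Mathlib

/-- A rule is strategy-proof if whenever a voter's misreport would give his true
preference, truthful reporting gives it as well. -/
def StrategyProof {N : Type*} [DecidableEq N] (f : (N → Bool) → Bool) : Prop :=
  ∀ (R : N → Bool) (i : N) (b : Bool), f (Function.update R i b) = R i → f R = R i

/-- A rule is neutral if it commutes with flipping the two candidates. -/
def Neutral {N : Type*} (f : (N → Bool) → Bool) : Prop :=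
  ∀ R : N → Bool, f (fun i => !(R i)) = !(f R)

/-- An M-winning coalition set: nonempty, members nonempty, minimality (P1),
and Moulin's property (P2). -/
def IsMWCS {N : Type*} [DecidableEq N] (𝒞 : Set (Finset N)) : Prop :=
  𝒞.Nonempty ∧ (∀ C ∈ 𝒞, C.Nonempty) ∧
    (∀ C ∈ 𝒞, ∀ C' ∈ 𝒞, C ⊆ C' → C = C') ∧
    (∀ C : Finset N, (∃ C' ∈ 𝒞, C' ⊆ C) ↔ ∀ C'' ∈ 𝒞, (C ∩ C'').Nonempty)

/-- `f` is the M-winning coalition rule associated with `𝒞`. -/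
def IsMWCRule {N : Type*} (𝒞 : Set (Finset N)) (f : (N → Bool) → Bool) : Prop :=
  ∀ (R : N → Bool) (x : Bool), f R = x ↔ ∃ C ∈ 𝒞, ∀ i ∈ C, R i = x

/-- `g` is the sequential unanimity rule associated with the sequence `S`. -/
def IsSURule {N : Type*} {K : ℕ} (S : Fin K → Finset N) (g : (N → Bool) → Bool) : Prop :=
  ∀ (R : N → Bool) (x : Bool),
    g R = x ↔ ∃ k : Fin K, (∀ i ∈ S k, R i = x) ∧
      ∀ l < k, ∃ i ∈ S l, ∃ j ∈ S l, R i ≠ R j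

/-- At every profile, some winning coalition of an M-winning coalition set is unanimous. -/
theorem stmt0 {N : Type*} [Fintype N] [DecidableEq N] (𝒞 : Set (Finset N))
    (h𝒞 : IsMWCS 𝒞) (R : N → Bool) :
    ∃ C ∈ 𝒞, ∃ x : Bool, ∀ i ∈ C, R i = x := by
  obtain ⟨-, -, -, h2⟩ := h𝒞
  by_cases h : ∃ C' ∈ 𝒞, C' ⊆ Finset.univ.filter (fun i => R i = true)
  · obtain ⟨C, hC, hs⟩ := h
    exact ⟨C, hC, true, fun i hi => (Finset.mem_filter.mp (hs hi)).2⟩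
  · rw [h2] at h
    push Not at h
    obtain ⟨C, hC, he⟩ := h
    refine ⟨C, hC, false, fun i hi => ?_⟩
    by_contra hne
    have hm : i ∈ Finset.univ.filter (fun i => R i = true) ∩ C := by
      simp [hi, Bool.eq_true_of_not_eq_false hne]
    simp [he] at hm
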